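/- arXiv:1809.07962 — 4 statements merged into one kernel-verified Lean document; each statement's English description precedes it below -/
import Mathlib

section
/- Let n ≥ 1 and let 0 < r₁ ≤ r₂. For every point c of the Euclidean space ℝⁿ, the Hausdorff distance between the sphere S(c, r₁) = {x ∈ ℝⁿ : ‖x − c‖ = r₁} and the sphere S(0, r₂) = {x ∈ ℝⁿ : ‖x‖ = r₂} is at least r₂ − r₁. (Consequently, the infimum over all isometrically embedded copies of the sphere of radius r₁ of its Hausdorff distance to a fixed sphere of radius r₂ equals r₂ − r₁, attained in the concentric position.) -/
theorem sphere_hausdorffDist_ge (n : ℕ) (hn : 1 ≤ n)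
    (r₁ r₂ : ℝ) (hr₁ : 0 < r₁) (hr : r₁ ≤ r₂) (c : EuclideanSpace ℝ (Fin n)) :
    r₂ - r₁ ≤
      Metric.hausdorffDist (Metric.sphere c r₁) (Metric.sphere (0 : EuclideanSpace ℝ (Fin n)) r₂) := by
  haveI : Nonempty (Fin n) := ⟨⟨0, hn⟩⟩
  have h2 : 0 ≤ r₂ := by linarith
  have ne1 : (Metric.sphere c r₁).Nonempty := NormedSpace.sphere_nonempty.2 hr₁.le
  have ne2 : (Metric.sphere (0 : EuclideanSpace ℝ (Fin n)) r₂).Nonempty :=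
    NormedSpace.sphere_nonempty.2 h2
  have fin := Metric.hausdorffEDist_ne_top_of_nonempty_of_bounded ne1 ne2
    Metric.isBounded_sphere Metric.isBounded_sphere
  have key : ∃ y ∈ Metric.sphere (0 : EuclideanSpace ℝ (Fin n)) r₂, r₂ ≤ dist y c := by
    obtain ⟨y, hy⟩ := ne2
    have hy' : ‖y‖ = r₂ := by simpa using hy
    by_contra! hcon
    have a := hcon y hy
    have b := hcon (-y) (by simpa using hy)
    have t := dist_triangle_right y (-y) c
    have e : dist y (-y) = 2 * r₂ := by
      rw [dist_eq_norm, sub_neg_eq_add, ← two_smul ℝ y, norm_smul, hy']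
      norm_num
    linarith
  obtain ⟨y, hy, hd⟩ := key
  by_contra! hlt
  obtain ⟨x, hx, hxy⟩ := Metric.exists_dist_lt_of_hausdorffDist_lt' hy hlt fin
  have hx' : dist x c = r₁ := hx
  have t := dist_triangle y x c
  rw [dist_comm y x] at t
  linarith
end

section
/- Let 0 < r₁ < r₂ and let 0 < ε < r₁. Then there exists a smooth map f : ℝ → ℝ² which is periodic with period 2πr₂, injective on the half-open interval [0, 2πr₂), satisfies ‖f′(t)‖ = 1 for all t ∈ ℝ (i.e. f is a unit-speed, arclength parametrization of a closed curve of length 2πr₂), and whose image is contained in the open annulus {x ∈ ℝ² : r₁ − ε < ‖x‖ < r₁ + ε}. In particular, the Hausdorff distance between the image of f and the circle {x ∈ ℝ² : ‖x‖ = r₁} is at most ε. -/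
open Real Metric Set

lemma aux_length (r₁ r₂ ε : ℝ) (hr₁ : 0 < r₁) (hr : r₁ < r₂) (hε : 0 < ε) :
    ∃ (n : ℕ) (a : ℝ), 0 ≤ a ∧ a ≤ ε / 2 ∧
      ∫ θ in (0:ℝ)..(2 * π), √((r₁ + a * sin (n * θ)) ^ 2 + (a * n * cos (n * θ)) ^ 2)
        = 2 * π * r₂ := by
  obtain ⟨n, hn⟩ := exists_nat_gt (2 * r₂ / (ε / 2))
  have hn0 : (0:ℝ) < n := lt_trans (by have : 0 < r₂ := hr₁.trans hr
                                       positivity) hn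
  have hn' : 2 * r₂ < n * (ε / 2) := by rwa [div_lt_iff₀ (by positivity)] at hn
  have hcont : Continuous (fun a : ℝ => ∫ θ in (0:ℝ)..(2 * π),
      √((r₁ + a * sin (n * θ)) ^ 2 + (a * n * cos (n * θ)) ^ 2)) := by
    apply intervalIntegral.continuous_parametric_intervalIntegral_of_continuous'
    fun_prop
  have h0 : (∫ θ in (0:ℝ)..(2 * π),
      √((r₁ + 0 * sin (n * θ)) ^ 2 + (0 * n * cos (n * θ)) ^ 2)) = 2 * π * r₁ := by
    simp [Real.sqrt_sq hr₁.le]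
  have h1 : 2 * π * r₂ ≤ ∫ θ in (0:ℝ)..(2 * π),
      √((r₁ + (ε/2) * sin (n * θ)) ^ 2 + ((ε/2) * n * cos (n * θ)) ^ 2) := by
    have hI : ∫ θ in (0:ℝ)..(2 * π), (ε/2) * n * ((1 + cos (2 * n * θ)) / 2)
        = (ε/2) * n * π := by
      have hd : ∀ x ∈ uIcc (0:ℝ) (2*π), HasDerivAt
          (fun θ : ℝ => (ε/2) * n * (θ / 2 + sin (2 * n * θ) / (4 * n)))
          ((ε/2) * n * ((1 + cos (2 * n * x)) / 2)) x := by
        intro x _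
        have h2 : HasDerivAt (fun θ : ℝ => 2 * n * θ) (2 * n) x := by
          simpa using (hasDerivAt_id x).const_mul (2 * (n:ℝ))
        have := ((((hasDerivAt_id x).div_const 2).add (h2.sin.div_const (4 * (n:ℝ)))).const_mul
          ((ε/2) * (n:ℝ)))
        refine this.congr_deriv ?_
        field_simp
        try ring
      rw [intervalIntegral.integral_eq_sub_of_hasDerivAt hd
        (Continuous.intervalIntegrable (by fun_prop) _ _)]
      have : sin (2 * n * (2 * π)) = 0 := by
        have := Real.sin_nat_mul_pi (4 * n)
        push_cast at this
        rw [← this]; congr 1; ring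
      rw [this]; simp
    calc 2 * π * r₂ ≤ (ε/2) * n * π := by nlinarith [Real.pi_pos]
      _ = _ := hI.symm
      _ ≤ _ := by
        apply intervalIntegral.integral_mono_on (by positivity)
          (Continuous.intervalIntegrable (by fun_prop) _ _)
          (Continuous.intervalIntegrable (by fun_prop) _ _)
        intro x _
        apply Real.le_sqrt_of_sq_le
        have hc : (1 + cos (2 * n * x)) / 2 = cos (n * x) ^ 2 := by
          rw [show 2 * (n:ℝ) * x = 2 * (n * x) by ring, Real.cos_two_mul]; ring
        rw [hc]
        have hc1 : cos (n * x) ^ 2 ≤ 1 := Real.cos_sq_le_one _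
        have : (cos (n * x) ^ 2) ^ 2 ≤ cos (n * x) ^ 2 := by
          nlinarith [sq_nonneg (cos (n * x))]
        have h3 : (ε / 2 * n) ^ 2 * (cos (n * x) ^ 2) ^ 2 ≤ (ε / 2 * n) ^ 2 * cos (n * x) ^ 2 := by
          gcongr
        nlinarith [sq_nonneg (r₁ + ε / 2 * sin (n * x))]
  have := intermediate_value_Icc (show (0:ℝ) ≤ ε / 2 by positivity) hcont.continuousOn
  obtain ⟨a, ha, hae⟩ := this ⟨h0.trans_le (by gcongr), h1⟩
  exact ⟨n, a, ha.1, ha.2, hae⟩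

lemma aux_norm (x y : ℝ) : ‖(!₂[x, y] : EuclideanSpace ℝ (Fin 2))‖ = √(x ^ 2 + y ^ 2) := by
  simp [EuclideanSpace.norm_eq, Fin.sum_univ_two]

lemma aux_norm_polar (ρ θ : ℝ) :
    ‖(!₂[ρ * cos θ, ρ * sin θ] : EuclideanSpace ℝ (Fin 2))‖ = |ρ| := by
  rw [aux_norm, ← Real.sqrt_sq_eq_abs]
  congr 1
  linear_combination ρ ^ 2 * Real.sin_sq_add_cos_sq θ

lemma aux_polar (x : EuclideanSpace ℝ (Fin 2)) :
    ∃ θ : ℝ, x = !₂[‖x‖ * cos θ, ‖x‖ * sin θ] := by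
  let z : ℂ := ⟨x 0, x 1⟩
  have hz : ‖z‖ = ‖x‖ := by
    rw [Complex.norm_def, Complex.normSq_apply, EuclideanSpace.norm_eq, Fin.sum_univ_two]
    simp [z, sq]
  refine ⟨z.arg, ?_⟩
  ext i
  fin_cases i
  · simp [← hz, Complex.norm_mul_cos_arg]; rfl
  · simp [← hz, Complex.norm_mul_sin_arg]; rfl

theorem exists_unit_speed_closed_curve_in_annulus
    (r₁ r₂ ε : ℝ) (hr₁ : 0 < r₁) (hr : r₁ < r₂) (hε : 0 < ε) (hεr : ε < r₁) :
    ∃ f : ℝ → EuclideanSpace ℝ (Fin 2),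
      ContDiff ℝ (⊤ : ℕ∞) f ∧
      Function.Periodic f (2 * π * r₂) ∧
      Set.InjOn f (Set.Ico 0 (2 * π * r₂)) ∧
      (∀ t : ℝ, ‖deriv f t‖ = 1) ∧
      (∀ t : ℝ, r₁ - ε < ‖f t‖ ∧ ‖f t‖ < r₁ + ε) ∧
      Metric.hausdorffDist (Set.range f)
        {x : EuclideanSpace ℝ (Fin 2) | ‖x‖ = r₁} ≤ ε := by
  obtain ⟨n, a, ha0, haε, hL⟩ := aux_length r₁ r₂ ε hr₁ hr hε
  set ρ : ℝ → ℝ := fun θ => r₁ + a * sin (n * θ) with hρ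
  set g : ℝ → ℝ := fun θ => √((r₁ + a * sin (n * θ)) ^ 2 + (a * n * cos (n * θ)) ^ 2) with hg
  have hdev : ∀ θ, |a * sin (n * θ)| ≤ ε / 2 := by
    intro θ
    rw [abs_mul, abs_of_nonneg ha0]
    calc a * |sin (n * θ)| ≤ a * 1 := by gcongr; exact Real.abs_sin_le_one _
      _ ≤ ε / 2 := by linarith
  have hρlo : ∀ θ, r₁ - ε / 2 ≤ ρ θ := fun θ => by
    have := (abs_le.1 (hdev θ)).1; simp only [hρ]; linarith
  have hρhi : ∀ θ, ρ θ ≤ r₁ + ε / 2 := fun θ => by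
    have := (abs_le.1 (hdev θ)).2; simp only [hρ]; linarith
  have hρpos : ∀ θ, 0 < ρ θ := fun θ => by linarith [hρlo θ]
  have hgge : ∀ θ, r₁ / 2 ≤ g θ := by
    intro θ
    apply Real.le_sqrt_of_sq_le
    have h1 : r₁ / 2 ≤ r₁ + a * sin (n * θ) := by linarith [show _ ≤ r₁ + a * sin (n * θ) from hρlo θ]
    nlinarith [sq_nonneg (a * n * cos (n * θ))]
  have hgpos : ∀ θ, 0 < g θ := fun θ => lt_of_lt_of_le (by positivity) (hgge θ)
  have hgsm : ContDiff ℝ (⊤ : ℕ∞) g := by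
    apply ContDiff.sqrt
    · fun_prop
    · intro θ
      have := hρpos θ
      have : 0 < (r₁ + a * sin (n * θ)) ^ 2 := by positivity
      positivity
  have hgper : ∀ θ, g (θ + 2 * π) = g θ := by
    intro θ
    have e : (n:ℝ) * (θ + 2 * π) = n * θ + n * (2 * π) := by ring
    simp only [hg, e, Real.sin_add_nat_mul_two_pi, Real.cos_add_nat_mul_two_pi]
  set s : ℝ → ℝ := fun θ => ∫ x in (0:ℝ)..θ, g x with hs
  have hsd : ∀ θ, HasDerivAt s (g θ) θ := fun θ =>
    intervalIntegral.integral_hasDerivAt_right (hgsm.continuous.intervalIntegrable _ _)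
      (hgsm.continuous.stronglyMeasurableAtFilter _ _) hgsm.continuous.continuousAt
  have hderiv : deriv s = g := funext fun θ => (hsd θ).deriv
  have hssm : ContDiff ℝ (⊤ : ℕ∞) s := by
    rw [contDiff_infty_iff_deriv]
    exact ⟨fun θ => (hsd θ).differentiableAt, hderiv ▸ hgsm⟩
  have hsmono : StrictMono s := strictMono_of_deriv_pos (fun θ => by rw [hderiv]; exact hgpos θ)
  have hs0 : s 0 = 0 := by simp [hs]
  have hslin : Monotone (fun θ => s θ - r₁ / 2 * θ) := by
    have hd : ∀ θ, HasDerivAt (fun θ => s θ - r₁ / 2 * θ) (g θ - r₁ / 2) θ := fun θ => by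
      exact ((hsd θ).sub ((hasDerivAt_id θ).const_mul (r₁ / 2))).congr_deriv (by simp)
    apply monotone_of_deriv_nonneg (fun θ => (hd θ).differentiableAt)
    intro θ
    rw [(hd θ).deriv]; linarith [hgge θ]
  have hssurj : Function.Surjective s := by
    apply hssm.continuous.surjective
    · apply Filter.tendsto_atTop_mono' _ _
        (Filter.tendsto_id.const_mul_atTop (show 0 < r₁ / 2 by positivity))
      filter_upwards [Filter.eventually_ge_atTop 0] with θ hθ
      have := hslin hθ
      simp [hs0] at this
      simpa using this
    · apply Filter.tendsto_atBot_mono' _ _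
        (Filter.tendsto_id.const_mul_atBot (show 0 < r₁ / 2 by positivity))
      filter_upwards [Filter.eventually_le_atBot 0] with θ hθ
      have := hslin hθ
      simp [hs0] at this
      simpa using this
  have hsper : ∀ θ, s (θ + 2 * π) = s θ + 2 * π * r₂ := by
    intro θ
    have hp : Function.Periodic g (2 * π) := hgper
    have h1 := hp.intervalIntegral_add_eq θ 0
    rw [zero_add] at h1
    rw [← hL]
    change _ = s θ + ∫ x in (0:ℝ)..(2 * π), g x
    rw [← h1]
    exact (intervalIntegral.integral_add_adjacent_intervals
      (hgsm.continuous.intervalIntegrable _ _) (hgsm.continuous.intervalIntegrable _ _)).symm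
  let S : ℝ ≃ₜ ℝ := (hsmono.orderIsoOfSurjective s hssurj).toHomeomorph
  have hS : ∀ θ, S θ = s θ := fun θ => rfl
  set u : ℝ → ℝ := fun t => S.symm t with hu
  have hsu : ∀ t, s (u t) = t := fun t => S.apply_symm_apply t
  have hus : ∀ t, u (s t) = t := fun t => S.symm_apply_apply t
  have husm : ContDiff ℝ (⊤ : ℕ∞) u :=
    S.contDiff_symm_deriv (f' := g) (fun θ => (hgpos θ).ne') (fun θ => hsd θ) hssm
  have hud : ∀ t, HasDerivAt u (g (u t))⁻¹ t := fun t =>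
    HasDerivAt.of_local_left_inverse husm.continuous.continuousAt (hsd (u t)) (hgpos _).ne'
      (Filter.Eventually.of_forall hsu)
  have huper : ∀ t, u (t + 2 * π * r₂) = u t + 2 * π := by
    intro t
    apply hsmono.injective
    rw [hsu, hsper, hsu]
  have humem : ∀ t ∈ Ico 0 (2 * π * r₂), u t ∈ Ico 0 (2 * π) := by
    intro t ht
    constructor
    · rw [← hsmono.le_iff_le, hsu, hs0]; exact ht.1
    · rw [← hsmono.lt_iff_lt, hsu]
      have := hsper 0
      rw [zero_add, hs0, zero_add] at this
      rw [this]; exact ht.2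
  set γ : ℝ → EuclideanSpace ℝ (Fin 2) := fun θ => !₂[ρ θ * cos θ, ρ θ * sin θ] with hγ
  have hρd : ∀ θ, HasDerivAt ρ (a * n * cos (n * θ)) θ := by
    intro θ
    have h2 : HasDerivAt (fun θ : ℝ => n * θ) (n : ℝ) θ := by
      simpa using (hasDerivAt_id θ).const_mul (n:ℝ)
    have := (h2.sin.const_mul a).const_add r₁
    exact this.congr_deriv (by ring)
  have hρsm : ContDiff ℝ (⊤ : ℕ∞) ρ := by fun_prop
  have hγsm : ContDiff ℝ (⊤ : ℕ∞) γ := by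
    rw [contDiff_euclidean]
    intro i
    fin_cases i
    · simp [hγ]; fun_prop
    · simp [hγ]; fun_prop
  have hγd : ∀ θ, HasDerivAt γ !₂[a * n * cos (n * θ) * cos θ + ρ θ * (- sin θ),
      a * n * cos (n * θ) * sin θ + ρ θ * cos θ] θ := by
    intro θ
    have h0 : HasDerivAt (fun θ => ![ρ θ * cos θ, ρ θ * sin θ])
        ![a * n * cos (n * θ) * cos θ + ρ θ * (- sin θ),
          a * n * cos (n * θ) * sin θ + ρ θ * cos θ] θ := by
      rw [hasDerivAt_pi]
      intro i
      fin_cases i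
      · exact (hρd θ).mul (Real.hasDerivAt_cos θ)
      · exact (hρd θ).mul (Real.hasDerivAt_sin θ)
    exact (PiLp.hasFDerivAt_toLp (𝕜 := ℝ) 2 _).comp_hasDerivAt θ h0
  have hγn : ∀ θ, ‖γ θ‖ = ρ θ := fun θ => by
    rw [hγ, aux_norm_polar, abs_of_pos (hρpos θ)]
  have hdist : ∀ θ, dist (γ θ) !₂[r₁ * cos θ, r₁ * sin θ] ≤ ε := by
    intro θ
    have : γ θ - !₂[r₁ * cos θ, r₁ * sin θ]
        = !₂[(a * sin (n * θ)) * cos θ, (a * sin (n * θ)) * sin θ] := by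
      ext i
      fin_cases i
      · simp [hγ, hρ]; ring
      · simp [hγ, hρ]; ring
    rw [dist_eq_norm, this, aux_norm_polar]
    linarith [hdev θ]
  refine ⟨fun t => γ (u t), hγsm.comp husm, ?_, ?_, ?_, ?_, ?_⟩
  · intro t
    have e : (n:ℝ) * (u t + 2 * π) = n * u t + n * (2 * π) := by ring
    simp only [hγ, hρ, huper, e, Real.sin_add_nat_mul_two_pi, Real.cos_add_two_pi,
      Real.sin_add_two_pi]
  · intro t₁ h₁ t₂ h₂ h
    simp only at h
    have hn : ρ (u t₁) = ρ (u t₂) := by rw [← hγn, ← hγn, h]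
    have hne := (hρpos (u t₂)).ne'
    have hc : cos (u t₁) = cos (u t₂) := by
      have := congrArg (fun v : EuclideanSpace ℝ (Fin 2) => v 0) h
      simpa [hγ, hn, hne] using this
    have hsn : sin (u t₁) = sin (u t₂) := by
      have := congrArg (fun v : EuclideanSpace ℝ (Fin 2) => v 1) h
      simpa [hγ, hn, hne] using this
    have hang : ((u t₁ : ℝ) : Real.Angle) = (u t₂ : ℝ) := Real.Angle.cos_sin_inj hc hsn
    obtain ⟨k, hk⟩ := Real.Angle.angle_eq_iff_two_pi_dvd_sub.1 hang
    have m1 := humem t₁ h₁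
    have m2 := humem t₂ h₂
    have hk0 : k = 0 := by
      have p := Real.pi_pos
      have a1 : (k:ℝ) < 1 := by
        by_contra hcon
        push Not at hcon
        nlinarith [m1.2, m2.1]
      have a2 : (-1:ℝ) < k := by
        by_contra hcon
        push Not at hcon
        nlinarith [m2.2, m1.1]
      have b1 : k < 1 := by exact_mod_cast a1
      have b2 : -1 < k := by exact_mod_cast a2
      omega
    rw [hk0] at hk
    have : u t₁ = u t₂ := by simp at hk; linarith
    rw [← hsu t₁, this, hsu]
  · intro t
    have h := (hγd (u t)).scomp t (hud t)
    have h' : deriv (fun t => γ (u t)) t = _ := h.deriv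
    rw [h', norm_smul, aux_norm, Real.norm_eq_abs, abs_of_pos (inv_pos.2 (hgpos _))]
    have : √((a * n * cos (n * u t) * cos (u t) + ρ (u t) * (- sin (u t))) ^ 2 +
      (a * n * cos (n * u t) * sin (u t) + ρ (u t) * cos (u t)) ^ 2) = g (u t) := by
      simp only [hg, hρ]
      congr 1
      linear_combination ((r₁ + a * sin (n * u t)) ^ 2 + (a * n * cos (n * u t)) ^ 2) *
        Real.sin_sq_add_cos_sq (u t)
    rw [this, inv_mul_cancel₀ (hgpos _).ne']
  · intro t
    simp only [hγn]
    constructor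
    · linarith [hρlo (u t)]
    · linarith [hρhi (u t)]
  · apply Metric.hausdorffDist_le_of_mem_dist hε.le
    · rintro _ ⟨t, rfl⟩
      refine ⟨!₂[r₁ * cos (u t), r₁ * sin (u t)], ?_, hdist _⟩
      rw [mem_ofPred_eq, aux_norm_polar, abs_of_pos hr₁]
    · intro x hx
      obtain ⟨θ, hθ⟩ := aux_polar x
      rw [mem_ofPred_eq] at hx
      rw [hx] at hθ
      refine ⟨γ θ, ⟨s θ, by simp only [hus]⟩, ?_⟩
      rw [dist_comm, hθ]
      exact hdist θ
end

section
/- Let 0 < r₁ < r₂. For every ε > 0 there exist smooth maps f₁, f₂ : ℝ → ℝ² such that for i = 1, 2 the map fᵢ is periodic with period 2πrᵢ, injective on [0, 2πrᵢ), and satisfies ‖fᵢ′(t)‖ = 1 for all t ∈ ℝ, and such that the Hausdorff distance between the image of f₁ and the image of f₂ is less than ε. In other words, the infimum, over all pairs of unit-speed closed curves in ℝ² of lengths 2πr₁ and 2πr₂ respectively, of the Hausdorff distance between their images is equal to 0, even though circles of circumferences 2πr₁ and 2πr₂ are not isometric. -/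
open Real Metric Set

lemma aux_reparam (ρ ρ' : ℝ → ℝ) (hρ : ∀ x, HasDerivAt ρ (ρ' x) x)
    (hs : ContDiff ℝ (⊤ : ℕ∞) ρ) (hs' : ContDiff ℝ (⊤ : ℕ∞) ρ') (hpos : ∀ x, 0 < ρ x)
    (hp : Function.Periodic ρ (2 * π)) (hp' : Function.Periodic ρ' (2 * π)) (L : ℝ)
    (hL : ∫ x in (0:ℝ)..(2 * π), √(ρ x ^ 2 + ρ' x ^ 2) = L) :
    ∃ f : ℝ → EuclideanSpace ℝ (Fin 2),
      (ContDiff ℝ (⊤ : ℕ∞) f ∧ Function.Periodic f L ∧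
          Set.InjOn f (Set.Ico 0 L) ∧ ∀ t : ℝ, ‖deriv f t‖ = 1) ∧
      Set.range f = Set.range (fun θ => (!₂[ρ θ * cos θ, ρ θ * sin θ] : EuclideanSpace ℝ (Fin 2))) := by
  set v : ℝ → ℝ := fun x => √(ρ x ^ 2 + ρ' x ^ 2) with hv
  have harg : ∀ x, 0 < ρ x ^ 2 + ρ' x ^ 2 := fun x => by have := hpos x; positivity
  have hvpos : ∀ x, 0 < v x := fun x => Real.sqrt_pos.2 (harg x)
  have hvs : ContDiff ℝ (⊤ : ℕ∞) v := ((hs.pow 2).add (hs'.pow 2)).sqrt (fun x => (harg x).ne')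
  have hvc : Continuous v := hvs.continuous
  have hvp : Function.Periodic v (2 * π) := fun x => by simp only [hv, hp x, hp' x]
  have hint : ∀ a b, IntervalIntegrable v MeasureTheory.volume a b :=
    fun a b => hvc.intervalIntegrable a b
  set s : ℝ → ℝ := fun x => ∫ y in (0:ℝ)..x, v y with hsdef
  have hsd : ∀ x, HasDerivAt s (v x) x := fun x => hvc.integral_hasStrictDerivAt 0 x |>.hasDerivAt
  have hds : deriv s = v := funext fun x => (hsd x).deriv
  have hss : ContDiff ℝ (⊤ : ℕ∞) s :=
    contDiff_infty_iff_deriv.2 ⟨fun x => (hsd x).differentiableAt, by rw [hds]; exact hvs⟩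
  have hmono : StrictMono s := strictMono_of_deriv_pos (fun x => by rw [hds]; exact hvpos x)
  have hLpos : 0 < ∫ x in (0:ℝ)..(2 * π), v x :=
    intervalIntegral.intervalIntegral_pos_of_pos (hint _ _) hvpos (by positivity)
  have hsurj : Function.Surjective s := by
    refine hss.continuous.surjective ?_ ?_
    · exact hvp.tendsto_atTop_intervalIntegral_of_pos hLpos (by positivity)
    · exact hvp.tendsto_atBot_intervalIntegral_of_pos hLpos (by positivity)
  have hs0 : s 0 = 0 := by simp [hsdef]
  have hsper : ∀ x, s (x + 2 * π) = s x + L := fun x => by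
    have := hvp.intervalIntegral_add_eq_add 0 x hint
    rw [zero_add, hL] at this
    exact this
  have hs2 : s (2 * π) = L := hL
  let e : ℝ ≃ₜ ℝ := (hmono.orderIsoOfSurjective s hsurj).toHomeomorph
  have he : ∀ x, e x = s x := fun x => rfl
  have heS : ContDiff ℝ (⊤ : ℕ∞) (e.symm : ℝ → ℝ) :=
    e.contDiff_symm_deriv (f' := v) (fun x => (hvpos x).ne') hsd hss
  have hse : ∀ t, s (e.symm t) = t := fun t => e.apply_symm_apply t
  have hed : ∀ t, HasDerivAt e.symm (v (e.symm t))⁻¹ t := fun t =>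
    HasDerivAt.of_local_left_inverse e.symm.continuous.continuousAt (hsd _) (hvpos _).ne'
      (Filter.Eventually.of_forall hse)
  let z : ℝ → EuclideanSpace ℝ (Fin 2) := fun θ => !₂[ρ θ * cos θ, ρ θ * sin θ]
  have hzs : ContDiff ℝ (⊤ : ℕ∞) z := by
    rw [contDiff_euclidean]
    intro i
    fin_cases i
    · exact hs.mul contDiff_cos
    · exact hs.mul contDiff_sin
  have hzd : ∀ x, HasDerivAt z
      (!₂[ρ' x * cos x + ρ x * (- sin x), ρ' x * sin x + ρ x * cos x] : EuclideanSpace ℝ (Fin 2)) x := by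
    intro x
    rw [hasDerivAt_iff_hasFDerivAt, ← hasFDerivWithinAt_univ, hasFDerivWithinAt_euclidean]
    intro i
    rw [hasFDerivWithinAt_univ]
    fin_cases i
    · refine ((hρ x).mul (hasDerivAt_cos x)).hasFDerivAt.congr_fderiv ?_
      ext
      simp
    · refine ((hρ x).mul (hasDerivAt_sin x)).hasFDerivAt.congr_fderiv ?_
      ext
      simp
  refine ⟨fun t => z (e.symm t), ⟨hzs.comp heS, ?_, ?_, ?_⟩, ?_⟩
  · intro t
    have : e.symm (t + L) = e.symm t + 2 * π := by
      apply hmono.injective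
      rw [hse, hsper, hse]
    simp only [this, z, hp _, cos_add_two_pi, sin_add_two_pi]
  · intro t ht u hu htu
    have key : ∀ t ∈ Ico 0 L, e.symm t ∈ Ico 0 (2 * π) := by
      intro t ht
      constructor
      · rw [← hmono.le_iff_le, hse, hs0]; exact ht.1
      · rw [← hmono.lt_iff_lt, hse, hs2]; exact ht.2
    have h1 := key t ht
    have h2 := key u hu
    apply e.symm.injective
    change z (e.symm t) = z (e.symm u) at htu
    generalize e.symm t = a at *
    generalize e.symm u = b at *
    have e0 : ρ a * cos a = ρ b * cos b := congrArg (fun w : EuclideanSpace ℝ (Fin 2) => w 0) htu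
    have e1 : ρ a * sin a = ρ b * sin b := congrArg (fun w : EuclideanSpace ℝ (Fin 2) => w 1) htu
    have hab : ρ a = ρ b := by
      have : ρ a ^ 2 = ρ b ^ 2 := by
        calc ρ a ^ 2 = (ρ a * cos a) ^ 2 + (ρ a * sin a) ^ 2 := by
              linear_combination (-ρ a ^ 2) * sin_sq_add_cos_sq a
          _ = (ρ b * cos b) ^ 2 + (ρ b * sin b) ^ 2 := by rw [e0, e1]
          _ = ρ b ^ 2 := by linear_combination (ρ b ^ 2) * sin_sq_add_cos_sq b
      exact (sq_eq_sq₀ (hpos a).le (hpos b).le).1 this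
    rw [hab] at e0 e1
    have c0 := mul_left_cancel₀ (hpos b).ne' e0
    have c1 := mul_left_cancel₀ (hpos b).ne' e1
    have hc : cos (a - b) = 1 := by
      rw [cos_sub, c0, c1]; linarith [sin_sq_add_cos_sq b]
    have := (cos_eq_one_iff_of_lt_of_lt (by linarith [h1.1, h2.2]) (by linarith [h1.2, h2.1])).1 hc
    linarith
  · intro t
    have h := (hzd (e.symm t)).scomp t (hed t)
    have h' : deriv (fun t => z (e.symm t)) t = _ := h.deriv
    rw [h', norm_smul, norm_inv, Real.norm_of_nonneg (hvpos _).le, EuclideanSpace.norm_eq]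
    have : √(∑ i, ‖(!₂[ρ' (e.symm t) * cos (e.symm t) + ρ (e.symm t) * (- sin (e.symm t)),
        ρ' (e.symm t) * sin (e.symm t) + ρ (e.symm t) * cos (e.symm t)] :
        EuclideanSpace ℝ (Fin 2)) i‖ ^ 2) = v (e.symm t) := by
      simp only [hv]
      congr 1
      simp only [Fin.sum_univ_two, Real.norm_eq_abs, sq_abs]
      simp
      linear_combination (ρ (e.symm t) ^ 2 + ρ' (e.symm t) ^ 2) * sin_sq_add_cos_sq (e.symm t)
    rw [this]
    exact inv_mul_cancel₀ (hvpos _).ne'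
  · exact e.symm.surjective.range_comp z

lemma aux_wiggle (r L a : ℝ) (n : ℕ) (hr : 0 < r) (ha : 0 ≤ a) (har : a < r)
    (hL : ∫ x in (0:ℝ)..(2 * π), √((r + a * sin (n * x)) ^ 2 + (a * (n * cos (n * x))) ^ 2) = L) :
    ∃ f : ℝ → EuclideanSpace ℝ (Fin 2),
      (ContDiff ℝ (⊤ : ℕ∞) f ∧ Function.Periodic f L ∧
          Set.InjOn f (Set.Ico 0 L) ∧ ∀ t : ℝ, ‖deriv f t‖ = 1) ∧
      Set.range f = Set.range (fun θ =>
        (!₂[(r + a * sin (n * θ)) * cos θ, (r + a * sin (n * θ)) * sin θ] :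
          EuclideanSpace ℝ (Fin 2))) := by
  have hper : ∀ x : ℝ, (n : ℝ) * (x + 2 * π) = n * x + n * (2 * π) := fun x => by ring
  refine aux_reparam (fun x => r + a * sin (n * x)) (fun x => a * (n * cos (n * x)))
    ?_ (by fun_prop) (by fun_prop) ?_ ?_ ?_ L hL
  · intro x
    have h1 : HasDerivAt (fun x : ℝ => (n : ℝ) * x) n x := by
      simpa using (hasDerivAt_id x).const_mul (n : ℝ)
    have h := ((h1.sin).const_mul a).const_add r
    rw [mul_comm (cos _)] at h
    exact h
  · intro x
    have := neg_one_le_sin (n * x)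
    show 0 < r + a * sin (n * x)
    nlinarith
  · intro x
    simp only [hper, sin_add_nat_mul_two_pi]
  · intro x
    simp only [hper, cos_add_nat_mul_two_pi]

theorem exists_close_unit_speed_closed_curves
    (r₁ r₂ : ℝ) (hr₁ : 0 < r₁) (hr : r₁ < r₂) :
    ∀ ε : ℝ, 0 < ε →
      ∃ f₁ f₂ : ℝ → EuclideanSpace ℝ (Fin 2),
        (ContDiff ℝ (⊤ : ℕ∞) f₁ ∧ Function.Periodic f₁ (2 * π * r₁) ∧
          Set.InjOn f₁ (Set.Ico 0 (2 * π * r₁)) ∧ ∀ t : ℝ, ‖deriv f₁ t‖ = 1) ∧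
        (ContDiff ℝ (⊤ : ℕ∞) f₂ ∧ Function.Periodic f₂ (2 * π * r₂) ∧
          Set.InjOn f₂ (Set.Ico 0 (2 * π * r₂)) ∧ ∀ t : ℝ, ‖deriv f₂ t‖ = 1) ∧
        Metric.hausdorffDist (Set.range f₁) (Set.range f₂) < ε := by
  intro ε hε
  obtain ⟨b, hb0, hbε, hbr⟩ : ∃ b : ℝ, 0 < b ∧ b < ε ∧ b < r₁ := by
    obtain ⟨b, h1, h2⟩ := exists_between (lt_min hε hr₁)
    exact ⟨b, h1, h2.trans_le (min_le_left _ _), h2.trans_le (min_le_right _ _)⟩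
  obtain ⟨n, hn⟩ := exists_nat_gt (2 * r₂ / b)
  have hn0 : (0:ℝ) < n := lt_trans (by have := hr₁.trans hr; positivity) hn
  rw [div_lt_iff₀ hb0] at hn
  let F : ℝ → ℝ := fun a =>
    ∫ x in (0:ℝ)..(2 * π), √((r₁ + a * sin (n * x)) ^ 2 + (a * (n * cos (n * x))) ^ 2)
  have hF : Continuous F := by
    apply intervalIntegral.continuous_parametric_intervalIntegral_of_continuous'
    simp only [Function.uncurry_def]
    fun_prop
  have hF0 : F 0 = 2 * π * r₁ := by
    simp [F, Real.sqrt_sq hr₁.le]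
  have hcos : ∫ x in (0:ℝ)..(2 * π), b * (n * cos (n * x) ^ 2) = b * n * π := by
    rw [intervalIntegral.integral_const_mul, intervalIntegral.integral_const_mul,
      intervalIntegral.integral_comp_mul_left (fun x => cos x ^ 2) hn0.ne', integral_cos_sq]
    have : sin ((n : ℝ) * (2 * π)) = 0 := by
      have := sin_add_nat_mul_two_pi 0 n
      simpa using this
    rw [this]
    simp
    field_simp
  have hFb : 2 * π * r₂ ≤ F b := by
    have : b * n * π ≤ F b := by
      rw [← hcos]
      apply intervalIntegral.integral_mono_on (by positivity)
      · exact Continuous.intervalIntegrable (by fun_prop) _ _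
      · exact Continuous.intervalIntegrable (by fun_prop) _ _
      · intro x _
        apply Real.le_sqrt_of_sq_le
        have h1 : cos (n * x) ^ 2 ≤ 1 := cos_sq_le_one _
        have h2 : (b * (n * cos (n * x) ^ 2)) ^ 2 = (b * (n * cos (n * x))) ^ 2 * cos (n * x) ^ 2 := by
          ring
        rw [h2]
        nlinarith [sq_nonneg (r₁ + b * sin (n * x)), sq_nonneg (b * (n * cos (n * x)))]
    nlinarith [pi_pos]
  obtain ⟨a, ha, haF⟩ : ∃ a ∈ Icc 0 b, F a = 2 * π * r₂ := by
    apply intermediate_value_Icc hb0.le hF.continuousOn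
    refine ⟨?_, hFb⟩
    rw [hF0]
    have := pi_pos
    gcongr
  obtain ⟨f₁, h₁, hR₁⟩ := aux_wiggle r₁ (2 * π * r₁) 0 n hr₁ le_rfl hr₁ hF0
  obtain ⟨f₂, h₂, hR₂⟩ := aux_wiggle r₁ (2 * π * r₂) a n hr₁ ha.1 (ha.2.trans_lt hbr) haF
  refine ⟨f₁, f₂, h₁, h₂, lt_of_le_of_lt ?_ hbε⟩
  rw [hR₁, hR₂]
  have hd : ∀ θ : ℝ, dist
      (!₂[(r₁ + 0 * sin (n * θ)) * cos θ, (r₁ + 0 * sin (n * θ)) * sin θ] :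
          EuclideanSpace ℝ (Fin 2))
      (!₂[(r₁ + a * sin (n * θ)) * cos θ, (r₁ + a * sin (n * θ)) * sin θ] :
          EuclideanSpace ℝ (Fin 2)) ≤ b := by
    intro θ
    rw [EuclideanSpace.dist_eq]
    apply Real.sqrt_le_iff.2 ⟨hb0.le, ?_⟩
    simp only [Fin.sum_univ_two, Real.dist_eq, sq_abs]
    simp
    have h1 : (a * sin (n * θ)) ^ 2 ≤ b ^ 2 := by
      rw [mul_pow]
      have := sin_sq_le_one (n * θ)
      have h3 : a ^ 2 ≤ b ^ 2 := by have := ha.1; have := ha.2; gcongr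
      nlinarith [sq_nonneg a]
    refine le_trans (le_of_eq ?_) h1
    linear_combination (a * sin (n * θ)) ^ 2 * sin_sq_add_cos_sq θ
  apply hausdorffDist_le_of_mem_dist hb0.le
  · rintro _ ⟨θ, rfl⟩
    exact ⟨_, ⟨θ, rfl⟩, hd θ⟩
  · rintro _ ⟨θ, rfl⟩
    refine ⟨_, ⟨θ, rfl⟩, ?_⟩
    rw [dist_comm]
    exact hd θ
end

section
/- Let 0 < r₁ < r₂ and define F(t) = t · (arsinh(r₂ / t) − arsinh(r₁ / t)) for t > 0. Then lim_{t → 0⁺} F(t) = 0. (Geometrically, F(t) is the Riemannian distance, in the hyperbolic space of constant curvature −t⁻², between the totally umbilic embedded spheres of radii r₁ and r₂; hence this Hausdorff distance between non-isometric spheres tends to zero as the curvature tends to −∞.) -/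
theorem tendsto_mul_arsinh_sub (r₁ r₂ : ℝ) (hr₁ : 0 < r₁) (hr : r₁ < r₂) :
    Filter.Tendsto (fun t : ℝ => t * (Real.arsinh (r₂ / t) - Real.arsinh (r₁ / t)))
      (nhdsWithin 0 (Set.Ioi 0)) (nhds 0) := by
  have hlim : Filter.Tendsto (fun t : ℝ => t * Real.log (r₂ / r₁))
      (nhdsWithin 0 (Set.Ioi 0)) (nhds 0) := by
    have h : Continuous (fun t : ℝ => t * Real.log (r₂ / r₁)) := by fun_prop
    have h2 := h.tendsto 0
    simp only [zero_mul] at h2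
    exact h2.mono_left nhdsWithin_le_nhds
  refine tendsto_of_tendsto_of_tendsto_of_le_of_le' tendsto_const_nhds hlim ?_ ?_
  · filter_upwards [self_mem_nhdsWithin] with t ht
    have ht : 0 < t := ht
    refine mul_nonneg ht.le (sub_nonneg.2 (Real.arsinh_le_arsinh.2 ?_))
    gcongr
  · filter_upwards [self_mem_nhdsWithin] with t ht
    have ht : 0 < t := ht
    refine mul_le_mul_of_nonneg_left ?_ ht.le
    rw [sub_le_iff_le_add, ← Real.exp_le_exp, Real.exp_add, Real.exp_log (by
      have := hr₁.trans hr
      positivity), Real.exp_arsinh, Real.exp_arsinh]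
    have hk : 1 ≤ r₂ / r₁ := (one_le_div hr₁).2 hr.le
    have hb : r₂ / t = r₂ / r₁ * (r₁ / t) := by field_simp
    rw [hb]
    generalize r₂ / r₁ = k at hk
    generalize r₁ / t = a
    rw [mul_add]
    gcongr
    apply Real.sqrt_le_iff.2
    refine ⟨by positivity, ?_⟩
    rw [mul_pow, mul_pow, Real.sq_sqrt (by positivity)]
    nlinarith
end
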